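/- Every residual (comeager) subset of the interval [0,1] has packing dimension equal to 1. -/

import Mathlib

open Filter Topology

/-- The `j`-th digit (for `j ≥ 1`) of the unique non-terminating base-`N` expansion
of `x ∈ [0,1]`. -/
noncomputable def digit (N : ℕ) (x : ℝ) (j : ℕ) : ℕ :=
  (⌈(N : ℝ) ^ j * x⌉ - (N : ℤ) * ⌈(N : ℝ) ^ (j - 1) * x⌉ + (N : ℤ) - 1).toNat

/-- `freqVec N x n i = Π_i(x,n)`, the frequency of digit `i` among the first `n` digits. -/
noncomputable def freqVec (N : ℕ) (x : ℝ) (n : ℕ) : Fin N → ℝ :=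
  fun i => (((Finset.Icc 1 n).filter (fun j => digit N x j = i.val)).card : ℝ) / n

/-- `p` is an accumulation point of the sequence `v` w.r.t. the ℓ¹ norm. -/
def IsAccPt1 (N : ℕ) (v : ℕ → Fin N → ℝ) (p : Fin N → ℝ) : Prop :=
  ∃ φ : ℕ → ℕ, StrictMono φ ∧
    Tendsto (fun u => ∑ k, |v (φ u) k - p k|) atTop (𝓝 0)

/-- The series `Σ f n` converges (in the classical sense) to `t`. -/
def SeriesTo (f : ℕ → ℝ) (t : ℝ) : Prop :=
  Tendsto (fun K => ∑ n ∈ Finset.range K, f n) atTop (𝓝 t)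

/-- `c` is a linear transformation: the series `Σ_n c m n * s n` converges for every
convergent sequence `s` and every row `m`. -/
def IsLinTrans (c : ℕ → ℕ → ℝ) : Prop :=
  ∀ s : ℕ → ℝ, (∃ l, Tendsto s atTop (𝓝 l)) → ∀ m, ∃ t, SeriesTo (fun n => c m n * s n) t

/-- `c` is a regular linear transformation: moreover, the averaged sequence converges to
the same limit. -/
def IsRegularLT (c : ℕ → ℕ → ℝ) : Prop :=
  IsLinTrans c ∧
    ∀ (s : ℕ → ℝ) (l : ℝ), Tendsto s atTop (𝓝 l) →
      ∀ t : ℕ → ℝ, (∀ m, SeriesTo (fun n => c m n * s n) (t m)) →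
        Tendsto t atTop (𝓝 l)

/-- The `T`-averaged digit frequency vector `Π^T(x,m)`. -/
noncomputable def freqT (N : ℕ) (c : ℕ → ℕ → ℝ) (x : ℝ) (m : ℕ) : Fin N → ℝ :=
  fun i => ∑' n, c m n * freqVec N x n i

/-- `𝔻`: rational probability vectors except `(1,0,...,0)` and `(0,...,0,1)`. -/
def Dset (N : ℕ) : Set (Fin N → ℝ) :=
  {q | q ∈ stdSimplex ℝ (Fin N) ∧ (∀ i, ∃ r : ℚ, q i = (r : ℝ)) ∧
    q ≠ (fun i => if i.val = 0 then 1 else 0) ∧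
    q ≠ (fun i => if i.val = N - 1 then 1 else 0)}

/-- `𝕀`: points of `[0,1]` with non-terminating base-`N` expansion. -/
def Iset (N : ℕ) : Set ℝ :=
  {x | x ∈ Set.Icc (0 : ℝ) 1 ∧ ¬∃ n k : ℕ, k < N ^ n ∧ x = (k : ℝ) / (N : ℝ) ^ n}

/-- Property `P_{h,ψ}` of a sequence in `ℝ^N`. -/
def PropP (N h : ℕ) (ψ : ℕ → ℕ) (v : ℕ → Fin N → ℝ) : Prop :=
  ∀ i m : ℕ, ∀ q ∈ Dset N, ∃ j : ℕ, i ≤ j ∧ (j : ℝ) / (ψ j : ℝ) ≤ 1 / (h : ℝ) ∧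
    ∀ n : ℕ, j ≤ n → n ≤ ψ^[m] j → ∑ k, |v n k - q k| < 1 / (h : ℝ)

/-- Number of grid intervals of length `1/n` meeting `E`. -/
noncomputable def boxCount (E : Set ℝ) (n : ℕ) : ℕ∞ :=
  {k : ℤ | (E ∩ Set.Ico ((k : ℝ) / n) (((k : ℝ) + 1) / n)).Nonempty}.encard

/-- Upper box (Minkowski) dimension of a subset of `ℝ`. -/
noncomputable def upperBoxDim (E : Set ℝ) : EReal :=
  Filter.limsup (fun n : ℕ =>
    if boxCount E n = ⊤ then (⊤ : EReal)
    else ((Real.log (boxCount E n).toNat / Real.log n : ℝ) : EReal)) Filter.atTop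

/-- Packing dimension of a subset of `ℝ`, via countable covers:
`dim_P F = inf { sup_n upperBoxDim (E n) : F ⊆ ⋃ n, E n }`. -/
noncomputable def packingDim (F : Set ℝ) : EReal :=
  sInf ((fun E : ℕ → Set ℝ => ⨆ n, upperBoxDim (E n)) '' {E | F ⊆ ⋃ n, E n})

theorem tendsto_log_const_mul_div_log {c : ℝ} (hc : 0 < c) :
    Tendsto (fun n : ℕ => ((Real.log (c * n) / Real.log n : ℝ) : EReal)) atTop (𝓝 1) := by
  have hlog : Tendsto (fun n : ℕ => Real.log n) atTop atTop :=
    Real.tendsto_log_atTop.comp tendsto_natCast_atTop_atTop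
  have h : Tendsto (fun n : ℕ => Real.log c / Real.log n + 1) atTop (𝓝 1) := by
    simpa using (hlog.const_div_atTop (Real.log c)).add_const 1
  refine (continuous_coe_real_ereal.tendsto (1 : ℝ)).comp (h.congr' ?_)
  filter_upwards [eventually_gt_atTop 1] with n hn
  have hn' : (1 : ℝ) < n := by exact_mod_cast hn
  have := Real.log_pos hn'
  rw [Real.log_mul hc.ne' (by positivity)]
  field_simp

theorem boxCount_le_of_subset_Icc {E : Set ℝ} (hE : E ⊆ Set.Icc 0 1) {n : ℕ} (hn : 0 < n) :
    boxCount E n ≤ (n + 1 : ℕ) := by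
  have hn' : (0 : ℝ) < n := by exact_mod_cast hn
  have hsub : {k : ℤ | (E ∩ Set.Ico ((k : ℝ) / n) (((k : ℝ) + 1) / n)).Nonempty} ⊆
      (Finset.Icc (0 : ℤ) n : Set ℤ) := by
    rintro k ⟨x, hx, hk, hk'⟩
    obtain ⟨h0, h1⟩ := hE hx
    rw [div_le_iff₀ hn'] at hk
    rw [lt_div_iff₀ hn'] at hk'
    have hlow : (0 : ℝ) < (k : ℝ) + 1 := lt_of_le_of_lt (by positivity) hk'
    have hup : (k : ℝ) ≤ n := by nlinarith
    have hlow' : 0 < k + 1 := by exact_mod_cast hlow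
    have hup' : k ≤ n := by exact_mod_cast hup
    simp only [Finset.coe_Icc, Set.mem_Icc]
    omega
  refine (Set.encard_le_encard hsub).trans ?_
  rw [Set.encard_coe_eq_coe_finsetCard, Int.card_Icc]
  exact_mod_cast (by omega : ((n : ℤ) + 1 - 0).toNat ≤ n + 1)

theorem upperBoxDim_le_one_of_subset_Icc {E : Set ℝ} (hE : E ⊆ Set.Icc 0 1) :
    upperBoxDim E ≤ 1 := by
  rw [← (tendsto_log_const_mul_div_log (c := 2) two_pos).limsup_eq]
  refine limsup_le_limsup ?_
  filter_upwards [eventually_gt_atTop 1] with n hn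
  have hb := boxCount_le_of_subset_Icc hE (by omega : 0 < n)
  have htop : boxCount E n ≠ ⊤ := ne_top_of_le_ne_top (ENat.natCast_ne_top _) hb
  have hnat : (boxCount E n).toNat ≤ n + 1 := ENat.toNat_le_of_le_natCast hb
  have hn' : (1 : ℝ) < n := by exact_mod_cast hn
  have hnat' : ((boxCount E n).toNat : ℝ) ≤ n + 1 := by exact_mod_cast hnat
  rw [if_neg htop, EReal.coe_le_coe_iff]
  refine div_le_div_of_nonneg_right ?_ (Real.log_pos hn').le
  rcases Nat.eq_zero_or_pos (boxCount E n).toNat with h0 | hpos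
  · rw [h0]
    simpa using Real.log_nonneg (by linarith : (1 : ℝ) ≤ 2 * n)
  · exact Real.log_le_log (by exact_mod_cast hpos) (by linarith)

theorem sub_two_le_boxCount {E : Set ℝ} {a b : ℝ} (hE : Set.Ioo a b ⊆ closure E) {n : ℕ}
    (hn : 0 < n) (htop : boxCount E n ≠ ⊤) :
    (b - a) * n - 2 ≤ (boxCount E n).toNat := by
  have hn' : (0 : ℝ) < n := by exact_mod_cast hn
  set s : Finset ℤ := Finset.Icc ⌈a * n⌉ (⌊b * n⌋ - 1) with hs
  have hsub : (s : Set ℤ) ⊆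
      {k : ℤ | (E ∩ Set.Ico ((k : ℝ) / n) (((k : ℝ) + 1) / n)).Nonempty} := by
    intro k hk
    rw [hs, Finset.coe_Icc, Set.mem_Icc, Int.ceil_le, Int.le_sub_one_iff, Int.lt_iff_add_one_le,
      Int.le_floor] at hk
    push_cast at hk
    have hlt : (k : ℝ) / n < ((k : ℝ) + 1) / n := by gcongr; linarith
    obtain ⟨y, hy⟩ := exists_between hlt
    have hya : y ∈ Set.Ioo a b :=
      ⟨lt_of_le_of_lt ((le_div_iff₀ hn').2 hk.1) hy.1,
        lt_of_lt_of_le hy.2 ((div_le_iff₀ hn').2 hk.2)⟩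
    obtain ⟨x, hx, hxE⟩ := mem_closure_iff.1 (hE hya) _ isOpen_Ioo hy
    exact ⟨x, hxE, hx.1.le, hx.2⟩
  have hcard : (s.card : ℕ∞) ≤ boxCount E n := by
    rw [← Set.encard_coe_eq_coe_finsetCard]
    exact Set.encard_le_encard hsub
  have hcard' : s.card ≤ (boxCount E n).toNat := by
    rw [← ENat.natCast_toNat htop] at hcard
    exact_mod_cast hcard
  have hle : ⌊b * n⌋ - ⌈a * n⌉ ≤ ((boxCount E n).toNat : ℤ) := by
    rw [hs, Int.card_Icc] at hcard'
    omega
  have hle' : (⌊b * n⌋ : ℝ) - ⌈a * n⌉ ≤ ((boxCount E n).toNat : ℝ) := by exact_mod_cast hle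
  linarith [Int.lt_floor_add_one (b * n), Int.ceil_lt_add_one (a * n)]

theorem one_le_upperBoxDim {E : Set ℝ} {a b : ℝ} (hab : a < b)
    (hE : Set.Ioo a b ⊆ closure E) : 1 ≤ upperBoxDim E := by
  have hc : 0 < (b - a) / 2 := by linarith
  rw [← (tendsto_log_const_mul_div_log hc).limsup_eq]
  refine limsup_le_limsup ?_
  have hlarge : ∀ᶠ n : ℕ in atTop, 2 ≤ (b - a) / 2 * n :=
    (tendsto_natCast_atTop_atTop.const_mul_atTop hc).eventually_ge_atTop 2
  filter_upwards [eventually_gt_atTop 1, hlarge] with n hn hn2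
  split_ifs with htop
  · exact le_top
  have hn' : (1 : ℝ) < n := by exact_mod_cast hn
  have := sub_two_le_boxCount hE (by omega) htop
  rw [EReal.coe_le_coe_iff]
  refine div_le_div_of_nonneg_right ?_ (Real.log_pos hn').le
  exact Real.log_le_log (by positivity) (by linarith)

/-- If countably many sets cover a residual subset of `[0,1]`, one of them is dense in some
interval. -/
theorem exists_Ioo_subset_closure_of_residual {R : Set ℝ}
    (hres : (Subtype.val ⁻¹' R : Set ↥(Set.Icc (0 : ℝ) 1)) ∈ residual ↥(Set.Icc (0 : ℝ) 1))
    {E : ℕ → Set ℝ} (hE : R ⊆ ⋃ n, E n) :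
    ∃ i, ∃ a b : ℝ, a < b ∧ Set.Ioo a b ⊆ closure (E i) := by
  obtain ⟨t, htR, htG, htD⟩ := mem_residual.1 hres
  have hdense := htG.dense_iUnion_interior_of_closed htD
    (f := fun i => (Subtype.val ⁻¹' closure (E i) : Set ↥(Set.Icc (0 : ℝ) 1)))
    (fun i => isClosed_closure.preimage continuous_subtype_val) (fun x hx => by
      obtain ⟨i, hi⟩ := Set.mem_iUnion.1 (hE (htR hx))
      exact Set.mem_iUnion.2 ⟨i, subset_closure hi⟩)
  obtain ⟨x, hx01, hx⟩ := hdense.inter_open_nonempty (Subtype.val ⁻¹' Set.Ioo (0 : ℝ) 1)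
    (isOpen_Ioo.preimage continuous_subtype_val)
    ⟨⟨1 / 2, by norm_num, by norm_num⟩, by norm_num, by norm_num⟩
  obtain ⟨i, hi⟩ := Set.mem_iUnion.1 hx
  obtain ⟨V, hVsub, hVo, hxV⟩ := mem_interior.1 hi
  obtain ⟨U, hUo, rfl⟩ := isOpen_induced_iff.1 hVo
  obtain ⟨a, b, hxab, hab⟩ :=
    mem_nhds_iff_exists_Ioo_subset.1 ((hUo.inter isOpen_Ioo).mem_nhds ⟨hxV, hx01⟩)
  refine ⟨i, a, b, hxab.1.trans hxab.2, fun y hy => ?_⟩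
  obtain ⟨hyU, hy01⟩ := hab hy
  exact @hVsub ⟨y, Set.Ioo_subset_Icc_self hy01⟩ hyU

/-- Every residual (comeager) subset of `[0,1]` has packing
dimension `1`. -/
theorem packingDim_of_residual (R : Set ℝ) (hR : R ⊆ Set.Icc (0 : ℝ) 1)
    (hres : (Subtype.val ⁻¹' R : Set ↥(Set.Icc (0 : ℝ) 1)) ∈
      residual ↥(Set.Icc (0 : ℝ) 1)) :
    packingDim R = 1 := by
  refine le_antisymm ?_ (le_sInf ?_)
  · refine sInf_le_of_le ⟨fun _ => R, Set.subset_iUnion (fun _ : ℕ => R) 0, rfl⟩ ?_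
    exact iSup_le fun _ => upperBoxDim_le_one_of_subset_Icc hR
  · rintro _ ⟨E, hE, rfl⟩
    obtain ⟨i, a, b, hab, hi⟩ := exists_Ioo_subset_closure_of_residual hres hE
    exact (one_le_upperBoxDim hab hi).trans (le_iSup (fun n => upperBoxDim (E n)) i)
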